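/- Weak comparison principle: let f be continuous and positive on (0,∞) with t ↦ f(t)/t^{p-1} non-increasing on (0,∞). If u₁, u₂ ∈ C^1(Ω) ∩ C^0(Ω̄) are positive on Ω̄, both are weak solutions of −Δ_p u = f(u) in Ω, and u₁ ≥ u₂ on ∂Ω, then u₁ ≥ u₂ in Ω. -/

import Mathlib

open scoped RealInnerProductSpace
open MeasureTheory

/-- `u` is a weak (distributional) solution of `-Δ_p u = f(u)` in `Ω`, with gradient
field `gu`: tested against smooth functions compactly supported in `Ω`. -/
def IsWeakPLaplaceSolution {N : ℕ} (Ω : Set (EuclideanSpace ℝ (Fin N))) (p : ℝ)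
    (f : ℝ → ℝ) (u : EuclideanSpace ℝ (Fin N) → ℝ)
    (gu : EuclideanSpace ℝ (Fin N) → EuclideanSpace ℝ (Fin N)) : Prop :=
  (∀ x ∈ Ω, HasGradientAt u (gu x) x) ∧
  ∀ φ : EuclideanSpace ℝ (Fin N) → ℝ, ContDiff ℝ (⊤ : ℕ∞) φ → HasCompactSupport φ →
    tsupport φ ⊆ Ω →
    ∫ x in Ω, ‖gu x‖ ^ (p - 2) * ⟪gu x, gradient φ x⟫ = ∫ x in Ω, f (u x) * φ x

section Flux

variable {E : Type*} [NormedAddCommGroup E] [InnerProductSpace ℝ E]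

/-- The flux `‖v‖ ^ (p - 2) • v` of the `p`-Laplacian. -/
noncomputable def pFlux (p : ℝ) (v : E) : E := ‖v‖ ^ (p - 2) • v

lemma norm_pFlux {p : ℝ} (hp : 1 < p) (v : E) : ‖pFlux p v‖ = ‖v‖ ^ (p - 1) := by
  rcases eq_or_ne v 0 with rfl | hv
  · simp [pFlux, Real.zero_rpow (by linarith : p - 1 ≠ 0)]
  · have h : 0 < ‖v‖ := norm_pos_iff.2 hv
    rw [pFlux, norm_smul, Real.norm_of_nonneg (by positivity), ← Real.rpow_add_one h.ne']
    ring_nf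

lemma inner_pFlux_self {p : ℝ} (hp : 1 < p) (v : E) : ⟪pFlux p v, v⟫ = ‖v‖ ^ p := by
  rcases eq_or_ne v 0 with rfl | hv
  · simp [Real.zero_rpow (by linarith : p ≠ 0)]
  · have h : 0 < ‖v‖ := norm_pos_iff.2 hv
    rw [pFlux, real_inner_smul_left, real_inner_self_eq_norm_sq, ← Real.rpow_natCast,
      ← Real.rpow_add h]
    norm_num

lemma continuous_pFlux {p : ℝ} (hp : 1 < p) : Continuous (pFlux p : E → E) := by
  refine continuous_iff_continuousAt.2 fun v => ?_
  rcases eq_or_ne v 0 with rfl | hv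
  · have h0 : pFlux p (0 : E) = 0 := by simp [pFlux]
    rw [ContinuousAt, h0, tendsto_zero_iff_norm_tendsto_zero]
    simp_rw [norm_pFlux hp]
    have : Continuous fun v : E => ‖v‖ ^ (p - 1) :=
      continuous_norm.rpow_const fun _ => Or.inr (by linarith)
    simpa [Real.zero_rpow (by linarith : p - 1 ≠ 0)] using this.tendsto 0
  · exact (continuousAt_id.norm.rpow_const (Or.inl (norm_ne_zero_iff.2 hv))).smul continuousAt_id

lemma pFlux_smul {p : ℝ} {c : ℝ} (hc : 0 < c) (v : E) :
    pFlux p (c • v) = c ^ (p - 1) • pFlux p v := by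
  rw [pFlux, pFlux, norm_smul, Real.norm_of_nonneg hc.le, Real.mul_rpow hc.le (norm_nonneg _),
    smul_smul, smul_smul]
  congr 1
  rw [show p - 1 = p - 2 + 1 by ring, Real.rpow_add_one hc.ne']
  ring

/-- Young's inequality for the flux, equivalent to convexity of `v ↦ ‖v‖ ^ p`. -/
lemma mul_inner_pFlux_le {p : ℝ} (hp : 1 < p) (v w : E) :
    p * ⟪pFlux p v, w⟫ ≤ (p - 1) * ‖v‖ ^ p + ‖w‖ ^ p := by
  have h1 : ⟪pFlux p v, w⟫ ≤ ‖w‖ * ‖v‖ ^ (p - 1) := by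
    rw [← norm_pFlux hp, mul_comm]; exact real_inner_le_norm _ _
  have hp1 : p - 1 ≠ 0 := by linarith
  have h2 := Real.young_inequality_of_nonneg (norm_nonneg w)
    (Real.rpow_nonneg (norm_nonneg v) (p - 1)) (Real.HolderConjugate.conjExponent hp)
  rw [← Real.rpow_mul (norm_nonneg v), Real.conjExponent, mul_div_cancel₀ _ hp1] at h2
  calc p * ⟪pFlux p v, w⟫ ≤ p * (‖w‖ ^ p / p + ‖v‖ ^ p / (p / (p - 1))) := by
        gcongr; exact h1.trans h2
    _ = _ := by field_simp; ring

/-- Strict monotonicity of the flux. -/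
lemma inner_pFlux_sub_pos {p : ℝ} (hp : 1 < p) {v w : E} (h : v ≠ w) :
    0 < ⟪pFlux p w - pFlux p v, w - v⟫ := by
  have hexp : ⟪pFlux p w - pFlux p v, w - v⟫ =
      ‖w‖ ^ p + ‖v‖ ^ p - ⟪pFlux p w, v⟫ - ⟪pFlux p v, w⟫ := by
    rw [← inner_pFlux_self hp, ← inner_pFlux_self hp]
    simp only [inner_sub_left, inner_sub_right]; ring
  have hpow : ∀ v : E, ‖v‖ ^ p = ‖v‖ ^ (p - 1) * ‖v‖ := fun v => by
    rw [← norm_pFlux hp, ← inner_pFlux_self hp, pFlux, real_inner_smul_left, norm_smul,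
      real_inner_self_eq_norm_mul_norm, Real.norm_of_nonneg (by positivity), mul_assoc]
  rcases eq_or_ne ‖v‖ ‖w‖ with hn | hn
  · have hw : 0 < ‖w‖ := by
      rcases (norm_nonneg w).eq_or_lt with h0 | h0
      · rw [← h0] at hn
        exact absurd ((norm_eq_zero.1 hn).trans (norm_eq_zero.1 h0.symm).symm) h
      · exact h0
    rw [pFlux, pFlux, hn, ← smul_sub, real_inner_smul_left, real_inner_self_eq_norm_sq]
    have := norm_pos_iff.2 (sub_ne_zero.2 h.symm)
    positivity
  · have h1 : ⟪pFlux p v, w⟫ ≤ ‖v‖ ^ (p - 1) * ‖w‖ := by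
      rw [← norm_pFlux hp]; exact real_inner_le_norm _ _
    have h2 : ⟪pFlux p w, v⟫ ≤ ‖w‖ ^ (p - 1) * ‖v‖ := by
      rw [← norm_pFlux hp]; exact real_inner_le_norm _ _
    have h3 : 0 < (‖w‖ ^ (p - 1) - ‖v‖ ^ (p - 1)) * (‖w‖ - ‖v‖) := by
      rcases hn.lt_or_gt with h | h
      · exact mul_pos (sub_pos.2 (Real.rpow_lt_rpow (norm_nonneg _) h (by linarith)))
          (sub_pos.2 h)
      · exact mul_pos_of_neg_of_neg
          (sub_neg.2 (Real.rpow_lt_rpow (norm_nonneg _) h (by linarith))) (sub_neg.2 h)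
    rw [hexp, hpow v, hpow w]
    nlinarith

end Flux

/-- `t ↦ (t⁺)²` is differentiable with derivative `2 t⁺`. -/
lemma hasDerivAt_max_zero_sq (t : ℝ) :
    HasDerivAt (fun s : ℝ => max s 0 ^ 2) (2 * max t 0) t := by
  have hne : ∀ y : ℝ, y ≠ 0 → HasDerivAt (fun s : ℝ => max s 0 ^ 2) (2 * max y 0) y := by
    intro y hy
    rcases hy.lt_or_gt with h | h
    · rw [max_eq_right h.le, mul_zero]
      refine (hasDerivAt_const y (0 : ℝ)).congr_of_eventuallyEq ?_
      filter_upwards [Iio_mem_nhds h] with s hs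
      simp [max_eq_right (Set.mem_Iio.1 hs).le]
    · rw [max_eq_left h.le]
      refine HasDerivAt.congr_of_eventuallyEq (f := fun s => s ^ 2) ?_ ?_
      · simpa using hasDerivAt_pow 2 y
      · filter_upwards [Ioi_mem_nhds h] with s hs
        simp [max_eq_left (Set.mem_Ioi.1 hs).le]
  rcases eq_or_ne t 0 with rfl | ht
  · exact hasDerivAt_of_hasDerivAt_of_ne hne (by fun_prop)
      (g := fun y => 2 * max y 0) (by fun_prop)
  · exact hne t ht

lemma contDiff_max_zero_sq : ContDiff ℝ 1 fun s : ℝ => max s 0 ^ 2 := by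
  refine contDiff_one_iff_deriv.2 ⟨fun t => (hasDerivAt_max_zero_sq t).differentiableAt, ?_⟩
  rw [funext fun t => (hasDerivAt_max_zero_sq t).deriv]
  fun_prop

section Approximation

open Filter Topology

/-- Extension by zero of a `C¹` function on an open set vanishing off a compact subset. -/
lemma contDiff_indicator_of_isCompact {E : Type*} [NormedAddCommGroup E] [NormedSpace ℝ E]
    {Ω K : Set E} (hΩ : IsOpen Ω) (hK : IsCompact K)
    (hKΩ : K ⊆ Ω) {g : E → ℝ} (hg : ContDiffOn ℝ 1 g Ω) (h0 : ∀ x ∈ Ω, x ∉ K → g x = 0) :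
    ContDiff ℝ 1 (Ω.indicator g) ∧ HasCompactSupport (Ω.indicator g) ∧
      tsupport (Ω.indicator g) ⊆ Ω := by
  have hsub : tsupport (Ω.indicator g) ⊆ K := by
    refine closure_minimal (fun x hx => ?_) hK.isClosed
    by_contra hxK
    refine hx ?_
    by_cases hxΩ : x ∈ Ω
    · simp [hxΩ, h0 x hxΩ hxK]
    · simp [hxΩ]
  refine ⟨contDiff_iff_contDiffAt.2 fun x => ?_,
    hK.of_isClosed_subset (isClosed_tsupport _) hsub, hsub.trans hKΩ⟩
  by_cases hx : x ∈ tsupport (Ω.indicator g)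
  swap
  · exact contDiffAt_const.congr_of_eventuallyEq (notMem_tsupport_iff_eventuallyEq.1 hx)
  have hx' : Ω ∈ 𝓝 x := hΩ.mem_nhds (hKΩ (hsub hx))
  refine (hg.contDiffAt hx').congr_of_eventuallyEq ?_
  filter_upwards [hx'] with y hy
  simp [hy]

section Mollification

variable {E : Type*} [NormedAddCommGroup E] [InnerProductSpace ℝ E] [FiniteDimensional ℝ E]
  [MeasurableSpace E] [BorelSpace E]

/-- Integrals of continuous functions with a common compact support and a common bound pass to
pointwise limits. -/
lemma tendsto_setIntegral_of_isCompact_support {Ω K : Set E} (hΩ : IsOpen Ω) (hK : IsCompact K)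
    {F : ℕ → E → ℝ} {F₀ : E → ℝ} {C : ℝ} (hF : ∀ n, ContinuousOn (F n) Ω)
    (hbound : ∀ n, ∀ x ∈ K, ‖F n x‖ ≤ C) (hsupp : ∀ n, ∀ x ∉ K, F n x = 0)
    (hlim : ∀ x, Tendsto (fun n => F n x) atTop (𝓝 (F₀ x))) :
    Tendsto (fun n => ∫ x in Ω, F n x) atTop (𝓝 (∫ x in Ω, F₀ x)) := by
  refine tendsto_integral_of_dominated_convergence (K.indicator fun _ => C)
    (fun n => (hF n).aestronglyMeasurable hΩ.measurableSet) ?_ ?_ (.of_forall hlim)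
  · refine Integrable.integrableOn ?_
    rw [integrable_indicator_iff hK.measurableSet]
    exact integrableOn_const hK.measure_lt_top.ne
  · refine fun n => .of_forall fun x => ?_
    by_cases hx : x ∈ K
    · simpa [hx] using hbound n x hx
    · simp [hx, hsupp n x hx]

lemma norm_normed_convolution_le {G : Type*} [NormedAddCommGroup G] [NormedSpace ℝ G]
    [CompleteSpace G] (b : ContDiffBump (0 : E)) {g : E → G} (hg : Continuous g) {C : ℝ}
    (hC : ∀ x, ‖g x‖ ≤ C) (x : E) :
    ‖(convolution (b.normed volume) g (ContinuousLinearMap.lsmul ℝ ℝ) volume) x‖ ≤ 3 * C := by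
  have h := b.dist_normed_convolution_le (μ := volume) (x₀ := x) (ε := 2 * C)
    hg.aestronglyMeasurable fun y _ => by
      rw [dist_eq_norm]
      linarith [norm_sub_le (g y) (g x), hC x, hC y]
  rw [dist_eq_norm] at h
  linarith [norm_sub_norm_le
    (convolution (b.normed volume) g (ContinuousLinearMap.lsmul ℝ ℝ) volume x) (g x), hC x]

/-- A divergence-form identity valid for smooth compactly supported test functions is valid for
`C¹` compactly supported ones. -/
lemma setIntegral_fderiv_eq_of_contDiff_one {Ω : Set E} (hΩ : IsOpen Ω) {X : E → E} {h : E → ℝ}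
    (hX : ContinuousOn X Ω) (hh : ContinuousOn h Ω)
    (H : ∀ φ : E → ℝ, ContDiff ℝ (⊤ : ℕ∞) φ → HasCompactSupport φ → tsupport φ ⊆ Ω →
      ∫ x in Ω, fderiv ℝ φ x (X x) = ∫ x in Ω, h x * φ x)
    {φ : E → ℝ} (hφ : ContDiff ℝ 1 φ) (hφc : HasCompactSupport φ) (hφΩ : tsupport φ ⊆ Ω) :
    ∫ x in Ω, fderiv ℝ φ x (X x) = ∫ x in Ω, h x * φ x := by
  obtain ⟨δ, hδ, hδΩ⟩ := IsCompact.exists_cthickening_subset_open hφc hΩ hφΩ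
  set K := Metric.cthickening δ (tsupport φ) with hKdef
  have hK : IsCompact K := IsCompact.cthickening hφc
  let b : ℕ → ContDiffBump (0 : E) := fun n =>
    { rIn := δ / (n + 2), rOut := δ / (n + 1), rIn_pos := by positivity,
      rIn_lt_rOut := by gcongr; norm_num }
  have hb : Tendsto (fun n => (b n).rOut) atTop (𝓝 0) :=
    (tendsto_const_div_atTop_nhds_zero_nat δ).comp (tendsto_add_atTop_nat 1) |>.congr
      fun n => by simp [b]
  have hbδ : ∀ n, (b n).rOut ≤ δ := fun n => div_le_self hδ.le (by simp)
  let ψ : ℕ → E → ℝ := fun n =>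
    convolution ((b n).normed volume) φ (ContinuousLinearMap.lsmul ℝ ℝ) volume
  have hψ : ∀ n, ContDiff ℝ (⊤ : ℕ∞) (ψ n) := fun n =>
    (b n).hasCompactSupport_normed.contDiff_convolution_left _ (b n).contDiff_normed
      hφ.continuous.locallyIntegrable
  have hψK : ∀ n, tsupport (ψ n) ⊆ K := fun n => by
    refine closure_minimal ?_ Metric.isClosed_cthickening
    refine (support_convolution_subset _).trans ?_
    rintro _ ⟨y, hy, z, hz, rfl⟩
    rw [(b n).support_normed_eq, mem_ball_zero_iff] at hy
    refine Metric.mem_cthickening_of_dist_le _ z _ _ (subset_tsupport _ hz) ?_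
    simpa [dist_eq_norm] using hy.le.trans (hbδ n)
  have hdψ : ∀ n x, fderiv ℝ (ψ n) x = convolution ((b n).normed volume) (fderiv ℝ φ)
      (ContinuousLinearMap.lsmul ℝ ℝ) volume x := fun n x => by
    rw [(hφc.hasFDerivAt_convolution_right (ContinuousLinearMap.lsmul ℝ ℝ)
      ((b n).continuous_normed).locallyIntegrable hφ x).fderiv]
    rfl
  have hφ' : Continuous (fderiv ℝ φ) := hφ.continuous_fderiv one_ne_zero
  obtain ⟨C₀, hC₀⟩ := hφc.exists_bound_of_continuous hφ.continuous
  obtain ⟨C₁, hC₁⟩ := (hφc.fderiv (𝕜 := ℝ)).exists_bound_of_continuous hφ'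
  obtain ⟨M, hM⟩ := hK.exists_bound_of_continuousOn (hX.mono hδΩ)
  obtain ⟨M', hM'⟩ := hK.exists_bound_of_continuousOn (hh.mono hδΩ)
  have hL : Tendsto (fun n => ∫ x in Ω, fderiv ℝ (ψ n) x (X x)) atTop
      (𝓝 (∫ x in Ω, fderiv ℝ φ x (X x))) := by
    refine tendsto_setIntegral_of_isCompact_support hΩ hK (C := 3 * C₁ * M)
      (fun n => (((hψ n).continuous_fderiv (by simp)).continuousOn).clm_apply hX) ?_ ?_ ?_
    · intro n x hx
      have h1 := norm_normed_convolution_le (b n) hφ' hC₁ x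
      rw [← hdψ] at h1
      calc _ ≤ ‖fderiv ℝ (ψ n) x‖ * ‖X x‖ := ContinuousLinearMap.le_opNorm _ _
        _ ≤ _ := mul_le_mul h1 (hM x hx) (norm_nonneg _) ((norm_nonneg _).trans h1)
    · intro n x hx
      rw [fderiv_of_notMem_tsupport (𝕜 := ℝ) fun h => hx (hψK n h)]
      simp
    · intro x
      have := ContDiffBump.convolution_tendsto_right_of_continuous (μ := volume) hb hφ' x
      simp_rw [← hdψ] at this
      exact ((ContinuousLinearMap.apply ℝ ℝ (X x)).continuous.tendsto _).comp this
  have hR : Tendsto (fun n => ∫ x in Ω, h x * ψ n x) atTop (𝓝 (∫ x in Ω, h x * φ x)) := by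
    refine tendsto_setIntegral_of_isCompact_support hΩ hK (C := M' * (3 * C₀))
      (fun n => hh.mul (hψ n).continuous.continuousOn) ?_ ?_ ?_
    · intro n x hx
      have h1 := norm_normed_convolution_le (b n) hφ.continuous hC₀ x
      rw [norm_mul]
      exact mul_le_mul (hM' x hx) h1 (norm_nonneg _) ((norm_nonneg _).trans (hM' x hx))
    · intro n x hx
      rw [image_eq_zero_of_notMem_tsupport fun h => hx (hψK n h), mul_zero]
    · exact fun x => (ContDiffBump.convolution_tendsto_right_of_continuous hb hφ.continuous
        x).const_mul _
  refine tendsto_nhds_unique hL (hR.congr fun n => (H _ (hψ n) ?_ ((hψK n).trans hδΩ)).symm)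
  exact hK.of_isClosed_subset (isClosed_tsupport _) (hψK n)

end Mollification

end Approximation

section Comparison

/-- The pointwise identity behind the Díaz–Saa inequality, with test functions built from
`((v₂ - v₁ - ε)⁺)²`, where `vᵢ` is the logarithm of the `i`-th solution. -/
lemma fderiv_testFunction_sub {E : Type*} [NormedAddCommGroup E] [InnerProductSpace ℝ E]
    [CompleteSpace E] {p : ℝ} (hp : 1 < p) (ε : ℝ) {v₁ v₂ : E → ℝ} {V₁ V₂ x : E}
    (h₁ : HasGradientAt v₁ V₁ x) (h₂ : HasGradientAt v₂ V₂ x) :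
    fderiv ℝ (fun y => Real.exp (p * v₂ y - (p - 1) * v₁ y) * max (v₂ y - v₁ y - ε) 0 ^ 2) x
        (pFlux p (Real.exp (v₁ x) • V₁)) -
      fderiv ℝ (fun y => Real.exp (v₂ y) * max (v₂ y - v₁ y - ε) 0 ^ 2) x
        (pFlux p (Real.exp (v₂ x) • V₂)) =
    Real.exp (p * v₂ x) *
      (max (v₂ x - v₁ x - ε) 0 ^ 2 *
          (p * ⟪pFlux p V₁, V₂⟫ - (p - 1) * ‖V₁‖ ^ p - ‖V₂‖ ^ p) -
        2 * max (v₂ x - v₁ x - ε) 0 * ⟪pFlux p V₂ - pFlux p V₁, V₂ - V₁⟫) := by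
  have d₁ := h₁.hasFDerivAt
  have d₂ := h₂.hasFDerivAt
  have dm := (hasDerivAt_max_zero_sq (v₂ x - v₁ x - ε)).comp_hasFDerivAt x
    ((d₂.sub d₁).sub_const ε)
  have e₁ : fderiv ℝ (fun y => Real.exp (p * v₂ y - (p - 1) * v₁ y) *
      max (v₂ y - v₁ y - ε) 0 ^ 2) x = _ :=
    (((d₂.const_mul p).sub (d₁.const_mul (p - 1))).exp.mul dm).fderiv
  have e₂ : fderiv ℝ (fun y => Real.exp (v₂ y) * max (v₂ y - v₁ y - ε) 0 ^ 2) x = _ :=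
    (d₂.exp.mul dm).fderiv
  rw [e₁, e₂]
  rw [pFlux_smul (Real.exp_pos _), pFlux_smul (Real.exp_pos _), ← Real.exp_mul, ← Real.exp_mul]
  have x₁ : Real.exp (p * v₂ x) =
      Real.exp (p * v₂ x - (p - 1) * v₁ x) * Real.exp (v₁ x * (p - 1)) := by
    rw [← Real.exp_add]; ring_nf
  have x₂ : Real.exp (p * v₂ x) = Real.exp (v₂ x) * Real.exp (v₂ x * (p - 1)) := by
    rw [← Real.exp_add]; ring_nf
  simp [inner_sub_left, inner_sub_right, real_inner_comm (pFlux p V₁),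
    real_inner_comm (pFlux p V₂), inner_pFlux_self hp]
  linear_combination
    -(max (v₂ x - v₁ x - ε) 0 ^ 2 * (p * ⟪pFlux p V₁, V₂⟫ - (p - 1) * ‖V₁‖ ^ p) +
        2 * max (v₂ x - v₁ x - ε) 0 * (⟪pFlux p V₁, V₂⟫ - ‖V₁‖ ^ p)) * x₁ +
      (max (v₂ x - v₁ x - ε) 0 ^ 2 * ‖V₂‖ ^ p +
        2 * max (v₂ x - v₁ x - ε) 0 * (‖V₂‖ ^ p - ⟪pFlux p V₂, V₁⟫)) * x₂

variable {N : ℕ} {Ω : Set (EuclideanSpace ℝ (Fin N))} {p : ℝ} {f : ℝ → ℝ}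
  {u : EuclideanSpace ℝ (Fin N) → ℝ} {gu : EuclideanSpace ℝ (Fin N) → EuclideanSpace ℝ (Fin N)}

lemma IsWeakPLaplaceSolution.continuousOn_gradient (h : IsWeakPLaplaceSolution Ω p f u gu)
    (hΩ : IsOpen Ω) (hu : ContDiffOn ℝ 1 u Ω) : ContinuousOn gu Ω := by
  have h1 := hu.continuousOn_fderiv_of_isOpen hΩ le_rfl
  refine ((InnerProductSpace.toDual ℝ _).symm.continuous.comp_continuousOn h1).congr
    fun x hx => ?_
  exact (h.1 x hx).gradient.symm

lemma IsWeakPLaplaceSolution.setIntegral_eq (h : IsWeakPLaplaceSolution Ω p f u gu)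
    (hΩ : IsOpen Ω) (hp : 1 < p) (hu : ContDiffOn ℝ 1 u Ω)
    (hfu : ContinuousOn (fun x => f (u x)) Ω)
    {φ : EuclideanSpace ℝ (Fin N) → ℝ} (hφ : ContDiff ℝ 1 φ) (hφc : HasCompactSupport φ)
    (hφΩ : tsupport φ ⊆ Ω) :
    ∫ x in Ω, fderiv ℝ φ x (pFlux p (gu x)) = ∫ x in Ω, f (u x) * φ x := by
  refine setIntegral_fderiv_eq_of_contDiff_one hΩ
    ((continuous_pFlux hp).comp_continuousOn (h.continuousOn_gradient hΩ hu)) hfu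
    (fun φ hφ hφc hφΩ => ?_) hφ hφc hφΩ
  rw [← h.2 φ hφ hφc hφΩ]
  refine integral_congr_ae (.of_forall fun x => ?_)
  simp only [Function.comp_apply, pFlux, map_smul, smul_eq_mul]
  rw [real_inner_comm, gradient, InnerProductSpace.toDual_symm_apply]

/-- The reaction terms are ordered when tested against the Díaz–Saa test functions. -/
lemma reaction_mul_testFunction_le (hmono : AntitoneOn (fun t => f t / t ^ (p - 1)) (Set.Ioi 0))
    {a b ε : ℝ} (hε : 0 ≤ ε) :
    f (Real.exp b) * (Real.exp b * max (b - a - ε) 0 ^ 2) ≤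
      f (Real.exp a) * (Real.exp (p * b - (p - 1) * a) * max (b - a - ε) 0 ^ 2) := by
  rcases le_or_gt (b - a - ε) 0 with h | h
  · simp [max_eq_right h]
  · have hab := hmono (Set.mem_Ioi.2 (Real.exp_pos a)) (Set.mem_Ioi.2 (Real.exp_pos b))
      (Real.exp_le_exp.2 (by linarith))
    simp only [← Real.exp_mul, div_eq_mul_inv, ← Real.exp_neg] at hab
    have hb : Real.exp b = Real.exp (-(b * (p - 1))) * Real.exp (p * b) := by
      rw [← Real.exp_add]; ring_nf
    have ha : Real.exp (p * b - (p - 1) * a) = Real.exp (-(a * (p - 1))) * Real.exp (p * b) := by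
      rw [← Real.exp_add]; ring_nf
    rw [ha]
    nth_rw 2 [hb]
    calc _ = f (Real.exp b) * Real.exp (-(b * (p - 1))) *
          (Real.exp (p * b) * max (b - a - ε) 0 ^ 2) := by ring
      _ ≤ f (Real.exp a) * Real.exp (-(a * (p - 1))) *
          (Real.exp (p * b) * max (b - a - ε) 0 ^ 2) := by gcongr
      _ = _ := by ring

lemma integrableOn_of_eq_zero_off_compact {E G : Type*} [TopologicalSpace E] [T2Space E]
    [MeasurableSpace E] [OpensMeasurableSpace E] {μ : Measure E} [IsFiniteMeasureOnCompacts μ]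
    [NormedAddCommGroup G] {Ω K : Set E} (hΩ : IsOpen Ω) (hK : IsCompact K) (hKΩ : K ⊆ Ω)
    {F : E → G} (hF : ContinuousOn F Ω) (h0 : ∀ x ∉ K, F x = 0) : IntegrableOn F Ω μ :=
  ((hF.mono hKΩ).integrableOn_compact' hK hK.measurableSet).of_forall_sdiff_eq_zero
    hΩ.measurableSet fun x hx => h0 x hx.2

/-- No positive solution exists when the whole space is compact and equal to the domain. -/
lemma IsWeakPLaplaceSolution.false_of_isCompact_univ (h : IsWeakPLaplaceSolution Set.univ p f u gu)
    (hc : IsCompact (Set.univ : Set (EuclideanSpace ℝ (Fin N))))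
    (hfu : Continuous fun x => f (u x)) (hpos : ∀ x, 0 < f (u x)) : False := by
  have h1 := h.2 (fun _ => 1) contDiff_const (hc.of_isClosed_subset isClosed_closure
    (Set.subset_univ _)) (Set.subset_univ _)
  have h2 : ∀ x : EuclideanSpace ℝ (Fin N), gradient (fun _ => (1 : ℝ)) x = 0 := fun x => by
    simp [gradient]
  simp only [h2, inner_zero_right, mul_zero, integral_zero, mul_one,
    Measure.restrict_univ] at h1
  refine h1.not_lt ((integral_pos_iff_support_of_nonneg (fun x => (hpos x).le) ?_).2 ?_)
  · exact integrableOn_univ.1 (hfu.continuousOn.integrableOn_compact hc)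
  · have : Function.support (fun x => f (u x)) = Set.univ := by
      ext x; simp [(hpos x).ne']
    rw [this]
    exact isOpen_univ.measure_pos _ Set.univ_nonempty

end Comparison

/-- Weak comparison principle for `-Δ_p u = f(u)` with `f` positive, continuous and
`t ↦ f(t)/t^(p-1)` non-increasing on `(0,∞)`. -/
theorem weak_comparison_principle {N : ℕ}
    (Ω : Set (EuclideanSpace ℝ (Fin N))) (hΩo : IsOpen Ω) (hΩb : Bornology.IsBounded Ω)
    (p : ℝ) (hp : 1 < p)
    (f : ℝ → ℝ) (hf : ContinuousOn f (Set.Ioi 0)) (hfpos : ∀ t > (0 : ℝ), 0 < f t)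
    (hmono : AntitoneOn (fun t => f t / t ^ (p - 1)) (Set.Ioi 0))
    (u₁ u₂ : EuclideanSpace ℝ (Fin N) → ℝ)
    (gu₁ gu₂ : EuclideanSpace ℝ (Fin N) → EuclideanSpace ℝ (Fin N))
    (hu₁C : ContinuousOn u₁ (closure Ω)) (hu₂C : ContinuousOn u₂ (closure Ω))
    (hu₁C1 : ContDiffOn ℝ 1 u₁ Ω) (hu₂C1 : ContDiffOn ℝ 1 u₂ Ω)
    (hu₁pos : ∀ x ∈ closure Ω, 0 < u₁ x) (hu₂pos : ∀ x ∈ closure Ω, 0 < u₂ x)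
    (hsol₁ : IsWeakPLaplaceSolution Ω p f u₁ gu₁)
    (hsol₂ : IsWeakPLaplaceSolution Ω p f u₂ gu₂)
    (hbd : ∀ x ∈ frontier Ω, u₂ x ≤ u₁ x) :
    ∀ x ∈ Ω, u₂ x ≤ u₁ x := by
  by_contra! hcon
  obtain ⟨x₀, hx₀, hlt⟩ := hcon
  have hsub : Ω ⊆ closure Ω := subset_closure
  let v₁ := fun x => Real.log (u₁ x)
  let v₂ := fun x => Real.log (u₂ x)
  have ev₁ : ∀ x ∈ Ω, Real.exp (v₁ x) = u₁ x := fun x hx => Real.exp_log (hu₁pos x (hsub hx))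
  have ev₂ : ∀ x ∈ Ω, Real.exp (v₂ x) = u₂ x := fun x hx => Real.exp_log (hu₂pos x (hsub hx))
  obtain ⟨ε, hε, hεx₀⟩ : ∃ ε > 0, ε < v₂ x₀ - v₁ x₀ :=
    exists_between (sub_pos.2 (Real.log_lt_log (hu₁pos x₀ (hsub hx₀)) hlt))
  -- the superlevel set carrying the test functions
  let K := closure Ω ∩ (fun x => v₂ x - v₁ x) ⁻¹' Set.Ici ε
  have hKc : IsCompact K := by
    refine hΩb.isCompact_closure.of_isClosed_subset ?_ Set.inter_subset_left
    exact ((hu₂C.log fun x hx => (hu₂pos x hx).ne').sub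
      (hu₁C.log fun x hx => (hu₁pos x hx).ne')).preimage_isClosed_of_isClosed
      isClosed_closure isClosed_Ici
  have hKΩ : K ⊆ Ω := by
    rintro x ⟨hx, hxε⟩
    by_contra hxΩ
    have h1 := Real.log_le_log (hu₂pos x hx) (hbd x (by rw [hΩo.frontier_eq]; exact ⟨hx, hxΩ⟩))
    have h2 : ε ≤ Real.log (u₂ x) - Real.log (u₁ x) := hxε
    linarith
  have hK0 : ∀ x ∈ Ω, x ∉ K → max (v₂ x - v₁ x - ε) 0 = 0 := fun x hx hxK =>
    max_eq_right (sub_nonpos.2 (not_le.1 fun h => hxK ⟨hsub hx, h⟩).le)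
  -- the test functions
  have cv₁ : ContDiffOn ℝ 1 v₁ Ω := hu₁C1.log fun x hx => (hu₁pos x (hsub hx)).ne'
  have cv₂ : ContDiffOn ℝ 1 v₂ Ω := hu₂C1.log fun x hx => (hu₂pos x (hsub hx)).ne'
  let q := fun x => max (v₂ x - v₁ x - ε) 0 ^ 2
  have cq : ContDiffOn ℝ 1 q Ω :=
    contDiff_max_zero_sq.comp_contDiffOn ((cv₂.sub cv₁).sub contDiffOn_const)
  let g₁ := fun x => Real.exp (p * v₂ x - (p - 1) * v₁ x) * max (v₂ x - v₁ x - ε) 0 ^ 2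
  let g₂ := fun x => Real.exp (v₂ x) * max (v₂ x - v₁ x - ε) 0 ^ 2
  have cg₁ : ContDiffOn ℝ 1 g₁ Ω :=
    ((contDiffOn_const.mul cv₂).sub (contDiffOn_const.mul cv₁)).exp.mul cq
  have cg₂ : ContDiffOn ℝ 1 g₂ Ω := cv₂.exp.mul cq
  obtain ⟨Cq, Sq, Tq⟩ := contDiff_indicator_of_isCompact hΩo hKc hKΩ cq
    fun x hx hxK => by simp [q, hK0 x hx hxK]
  obtain ⟨C₁, S₁, T₁⟩ := contDiff_indicator_of_isCompact hΩo hKc hKΩ cg₁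
    fun x hx hxK => by simp [g₁, hK0 x hx hxK]
  obtain ⟨C₂, S₂, T₂⟩ := contDiff_indicator_of_isCompact hΩo hKc hKΩ cg₂
    fun x hx hxK => by simp [g₂, hK0 x hx hxK]
  have hfu₁ : ContinuousOn (fun x => f (u₁ x)) Ω :=
    hf.comp hu₁C1.continuousOn fun x hx => hu₁pos x (hsub hx)
  have hfu₂ : ContinuousOn (fun x => f (u₂ x)) Ω :=
    hf.comp hu₂C1.continuousOn fun x hx => hu₂pos x (hsub hx)
  have I₁ := hsol₁.setIntegral_eq hΩo hp hu₁C1 hfu₁ C₁ S₁ T₁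
  have I₂ := hsol₂.setIntegral_eq hΩo hp hu₂C1 hfu₂ C₂ S₂ T₂
  have hind : ∀ (g : EuclideanSpace ℝ (Fin N) → ℝ), ∀ x ∈ Ω,
      fderiv ℝ (Ω.indicator g) x = fderiv ℝ g x := fun g x hx => by
    refine Filter.EventuallyEq.fderiv_eq ?_
    filter_upwards [hΩo.mem_nhds hx] with y hy using Set.indicator_of_mem hy g
  -- gradients of the logarithms
  let V₁ := fun x => (u₁ x)⁻¹ • gu₁ x
  let V₂ := fun x => (u₂ x)⁻¹ • gu₂ x
  have hV : ∀ {u : EuclideanSpace ℝ (Fin N) → ℝ} {gu : EuclideanSpace ℝ (Fin N)}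
      {x : EuclideanSpace ℝ (Fin N)}, HasGradientAt u gu x → 0 < u x →
      HasGradientAt (fun y => Real.log (u y)) ((u x)⁻¹ • gu) x := fun h h0 => by
    rw [hasGradientAt_iff_hasFDerivAt, map_smul]
    exact h.hasFDerivAt.log h0.ne'
  have hV₁ : ∀ x ∈ Ω, HasGradientAt v₁ (V₁ x) x := fun x hx =>
    hV (hsol₁.1 x hx) (hu₁pos x (hsub hx))
  have hV₂ : ∀ x ∈ Ω, HasGradientAt v₂ (V₂ x) x := fun x hx =>
    hV (hsol₂.1 x hx) (hu₂pos x (hsub hx))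
  have egu₁ : ∀ x ∈ Ω, Real.exp (v₁ x) • V₁ x = gu₁ x := fun x hx => by
    rw [ev₁ x hx, smul_inv_smul₀ (hu₁pos x (hsub hx)).ne']
  have egu₂ : ∀ x ∈ Ω, Real.exp (v₂ x) • V₂ x = gu₂ x := fun x hx => by
    rw [ev₂ x hx, smul_inv_smul₀ (hu₂pos x (hsub hx)).ne']
  let D := fun x => fderiv ℝ (Ω.indicator g₂) x (pFlux p (gu₂ x)) -
    fderiv ℝ (Ω.indicator g₁) x (pFlux p (gu₁ x))
  have hD : ∀ x ∈ Ω, D x = Real.exp (p * v₂ x) *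
      (max (v₂ x - v₁ x - ε) 0 ^ 2 *
          ((p - 1) * ‖V₁ x‖ ^ p + ‖V₂ x‖ ^ p - p * ⟪pFlux p (V₁ x), V₂ x⟫) +
        2 * max (v₂ x - v₁ x - ε) 0 * ⟪pFlux p (V₂ x) - pFlux p (V₁ x), V₂ x - V₁ x⟫) := by
    intro x hx
    have := fderiv_testFunction_sub hp ε (hV₁ x hx) (hV₂ x hx)
    rw [egu₁ x hx, egu₂ x hx] at this
    simp only [D, hind _ x hx]
    linear_combination -this
  have hmonoFlux : ∀ x, 0 ≤ ⟪pFlux p (V₂ x) - pFlux p (V₁ x), V₂ x - V₁ x⟫ := fun x => by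
    rcases eq_or_ne (V₁ x) (V₂ x) with h | h
    · simp [h]
    · exact (inner_pFlux_sub_pos hp h).le
  have hD0 : ∀ x ∈ Ω, 0 ≤ D x := fun x hx => by
    rw [hD x hx]
    have h1 := sub_nonneg.2 (mul_inner_pFlux_le hp (V₁ x) (V₂ x))
    have h2 := hmonoFlux x
    positivity
  have hXc : ∀ {φ : EuclideanSpace ℝ (Fin N) → ℝ}
      {X : EuclideanSpace ℝ (Fin N) → EuclideanSpace ℝ (Fin N)}, ContDiff ℝ 1 φ →
      ContinuousOn X Ω → ContinuousOn (fun x => fderiv ℝ φ x (pFlux p (X x))) Ω :=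
    fun hφ hX => (hφ.continuous_fderiv one_ne_zero).continuousOn.clm_apply
      ((continuous_pFlux hp).comp_continuousOn hX)
  have c₁ := hXc C₁ (hsol₁.continuousOn_gradient hΩo hu₁C1)
  have c₂ := hXc C₂ (hsol₂.continuousOn_gradient hΩo hu₂C1)
  have i₁ := integrableOn_of_eq_zero_off_compact (μ := volume) hΩo S₁ T₁ c₁
    fun x hx => by rw [fderiv_of_notMem_tsupport (𝕜 := ℝ) hx]; rfl
  have i₂ := integrableOn_of_eq_zero_off_compact (μ := volume) hΩo S₂ T₂ c₂
    fun x hx => by rw [fderiv_of_notMem_tsupport (𝕜 := ℝ) hx]; rfl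
  have j₁ := integrableOn_of_eq_zero_off_compact (μ := volume) hΩo S₁ T₁
    (hfu₁.mul C₁.continuous.continuousOn)
    fun x hx => by simp [image_eq_zero_of_notMem_tsupport hx]
  have j₂ := integrableOn_of_eq_zero_off_compact (μ := volume) hΩo S₂ T₂
    (hfu₂.mul C₂.continuous.continuousOn)
    fun x hx => by simp [image_eq_zero_of_notMem_tsupport hx]
  have hle : ∫ x in Ω, f (u₂ x) * Ω.indicator g₂ x ≤ ∫ x in Ω, f (u₁ x) * Ω.indicator g₁ x := by
    refine setIntegral_mono_on j₂ j₁ hΩo.measurableSet fun x hx => ?_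
    rw [Set.indicator_of_mem hx, Set.indicator_of_mem hx, ← ev₁ x hx, ← ev₂ x hx]
    exact reaction_mul_testFunction_le hmono hε.le
  have hD0ae : 0 ≤ᵐ[volume.restrict Ω] D := ae_restrict_of_forall_mem hΩo.measurableSet hD0
  have hDint : ∫ x in Ω, D x = 0 := by
    refine le_antisymm ?_ (integral_nonneg_of_ae hD0ae)
    rw [integral_sub i₂ i₁, I₁, I₂]
    linarith
  have hDzero : Set.EqOn D 0 Ω := Measure.eqOn_open_of_ae_eq
    ((setIntegral_eq_zero_iff_of_nonneg_ae hD0ae (i₂.sub i₁)).1 hDint) hΩo (c₂.sub c₁)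
    continuousOn_const
  -- the logarithmic gap has zero gradient where it exceeds `ε`
  have hq' : ∀ x, fderiv ℝ (Ω.indicator q) x = 0 := by
    intro x
    by_cases hx : x ∈ Ω
    · have dq := (hasDerivAt_max_zero_sq (v₂ x - v₁ x - ε)).comp_hasFDerivAt x
        (((hV₂ x hx).hasFDerivAt.sub (hV₁ x hx).hasFDerivAt).sub_const ε)
      have hqx : fderiv ℝ q x = _ := dq.fderiv
      rw [hind q x hx, hqx, ← map_sub]
      rcases (le_max_right (v₂ x - v₁ x - ε) 0).eq_or_lt with h | h
      · rw [← h]; simp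
      · have hVeq : V₁ x = V₂ x := by
          by_contra hne
          have h0 : D x = 0 := hDzero hx
          have h1 := sub_nonneg.2 (mul_inner_pFlux_le hp (V₁ x) (V₂ x))
          have h2 := inner_pFlux_sub_pos hp hne
          have : 0 < D x := by rw [hD x hx]; positivity
          exact this.ne' h0
        simp [hVeq]
    · exact fderiv_of_notMem_tsupport (𝕜 := ℝ) fun h => hx (Tq h)
  have hconst := is_const_of_fderiv_eq_zero (Cq.differentiable one_ne_zero) hq'
  have huniv : tsupport (Ω.indicator q) = Set.univ := by
    refine Set.eq_univ_of_forall fun x => subset_tsupport _ ?_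
    rw [Function.mem_support, hconst x x₀, Set.indicator_of_mem hx₀]
    exact (pow_pos (lt_max_of_lt_left (sub_pos.2 hεx₀)) 2).ne'
  have hΩuniv : Ω = Set.univ := Set.univ_subset_iff.1 (huniv ▸ Tq)
  subst hΩuniv
  exact hsol₁.false_of_isCompact_univ (huniv ▸ Sq) (continuousOn_univ.1 hfu₁)
    fun x => hfpos _ (hu₁pos x (hsub trivial))
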